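/- arXiv:2510.25684 — 6 statements merged into one kernel-verified Lean document; each statement's English description precedes it below -/
import Mathlib

section
/- Let V be a finite set (of attributes), E a finite set of ordered pairs (x,y) of distinct elements of V (edges) such that every element of V occurs in at least one edge, D a type, and N ≥ 1 a natural number. Suppose each edge e = (x,y) ∈ E carries a finite relation R_e ⊆ D × D with |R_e| ≤ N. Then the number of maps t : V → D satisfying (t x, t y) ∈ R_e for every edge e = (x,y) ∈ E is at most the supremum, over all fractional vertex packings u of the query graph (V,E), of N^{∑_{x∈V} u x} (this supremum is taken over a nonempty set, since u = 0 is a packing, and the quantities N^{∑ u x} are bounded above by N^{|V|}). -/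
open scoped Classical in
/-- The members of `T` that agree with `t` on `A`. -/
noncomputable def agreeing {V D : Type} (T : Finset (V → D)) (A : Finset V) (t : V → D) :
    Finset (V → D) :=
  {s ∈ T | ∀ v ∈ A, s v = t v}

/-- The conditional entropy of a uniformly random `t ∈ T` given its restriction to `A`. -/
noncomputable def residualEntropy {V D : Type} (T : Finset (V → D)) (A : Finset V) : ℝ :=
  (∑ t ∈ T, Real.log ((agreeing T A t).card : ℝ)) / T.card

section Entropy

variable {V D : Type} {T : Finset (V → D)} {A B : Finset V} {s t : V → D}

theorem mem_agreeing : s ∈ agreeing T A t ↔ s ∈ T ∧ ∀ v ∈ A, s v = t v := by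
  classical
  simp [agreeing]

theorem agreeing_congr (h : ∀ v ∈ A, s v = t v) : agreeing T A s = agreeing T A t := by
  ext r
  simp only [mem_agreeing]
  exact and_congr_right fun _ => forall₂_congr fun v hv => by rw [h v hv]

theorem card_agreeing_pos (ht : t ∈ T) : (0 : ℝ) < (agreeing T A t).card := by
  exact_mod_cast Finset.card_pos.mpr ⟨t, mem_agreeing.mpr ⟨ht, fun _ _ => rfl⟩⟩

theorem residualEntropy_anti (h : A ⊆ B) : residualEntropy T B ≤ residualEntropy T A := by
  refine div_le_div_of_nonneg_right (Finset.sum_le_sum fun t ht => ?_) (Nat.cast_nonneg _)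
  refine Real.log_le_log (card_agreeing_pos ht) ?_
  exact_mod_cast Finset.card_le_card fun s hs =>
    mem_agreeing.mpr ⟨(mem_agreeing.mp hs).1, fun v hv => (mem_agreeing.mp hs).2 v (h hv)⟩

theorem residualEntropy_empty (hT : T.Nonempty) :
    residualEntropy T ∅ = Real.log (T.card : ℝ) := by
  have h (t : V → D) : agreeing T ∅ t = T := by ext; simp [mem_agreeing]
  have hc : (T.card : ℝ) ≠ 0 := by exact_mod_cast hT.card_ne_zero
  simp only [residualEntropy, h, Finset.sum_const, nsmul_eq_mul]
  field_simp

theorem residualEntropy_univ [Fintype V] : residualEntropy T Finset.univ = 0 := by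
  have h : ∀ t ∈ T, agreeing T Finset.univ t = {t} := fun t ht => by
    ext s
    rw [mem_agreeing, Finset.mem_singleton]
    exact ⟨fun hs => funext fun v => hs.2 v (Finset.mem_univ v),
      fun hs => ⟨hs ▸ ht, fun v _ => congrFun hs v⟩⟩
  rw [residualEntropy, Finset.sum_eq_zero fun t ht => by simp [h t ht], zero_div]

/-- A set of elements of `T` agreeing pairwise on `A` has total weight at most one when each
element is weighted by the inverse size of its class. -/
theorem sum_inv_card_agreeing_le_one {S : Finset (V → D)} (hST : S ⊆ T)
    (h : ∀ s ∈ S, ∀ t ∈ S, ∀ v ∈ A, s v = t v) :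
    ∑ t ∈ S, ((agreeing T A t).card : ℝ)⁻¹ ≤ 1 := by
  rcases S.eq_empty_or_nonempty with rfl | ⟨r, hr⟩
  · simp
  · rw [Finset.sum_congr rfl fun t ht => by rw [agreeing_congr (h t ht r hr)], Finset.sum_const,
      nsmul_eq_mul, ← div_eq_mul_inv, div_le_one (card_agreeing_pos (hST hr))]
    exact_mod_cast Finset.card_le_card fun s hs => mem_agreeing.mpr ⟨hST hs, h s hs r hr⟩

/-- The number of classes of agreement on `A` is at most the size of any set into which `T`
maps by a map that determines the coordinates in `A`. -/
theorem sum_inv_card_agreeing_le_card {α : Type} (f : (V → D) → α) (P : Finset α)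
    (hf : ∀ t ∈ T, f t ∈ P) (hA : ∀ s t, f s = f t → ∀ v ∈ A, s v = t v) :
    ∑ t ∈ T, ((agreeing T A t).card : ℝ)⁻¹ ≤ P.card := by
  classical
  rw [← Finset.sum_fiberwise_of_maps_to hf, Finset.card_eq_sum_ones, Nat.cast_sum, Nat.cast_one]
  refine Finset.sum_le_sum fun p _ => sum_inv_card_agreeing_le_one (Finset.filter_subset _ _) ?_
  intro s hs t ht
  exact hA s t ((Finset.mem_filter.mp hs).2.trans (Finset.mem_filter.mp ht).2.symm)

theorem sum_agreeing_ratio_le [DecidableEq V] (T : Finset (V → D)) (A B : Finset V) :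
    ∑ t ∈ T, ((agreeing T A t).card * (agreeing T B t).card : ℝ) *
      (((agreeing T (A ∪ B) t).card : ℝ)⁻¹ * ((agreeing T (A ∩ B) t).card : ℝ)⁻¹) ≤ T.card := by
  classical
  set w : (V → D) → ℝ := fun t => ((agreeing T (A ∪ B) t).card : ℝ)⁻¹
  set c : (V → D) → ℝ := fun t => ((agreeing T (A ∩ B) t).card : ℝ)⁻¹
  calc
    _ = ∑ t ∈ T, ∑ s ∈ agreeing T A t, ∑ r ∈ agreeing T B t, w t * c t := by
      refine Finset.sum_congr rfl fun t _ => ?_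
      simp only [Finset.sum_const, nsmul_eq_mul, mul_assoc, w, c]
    _ = ∑ s ∈ T, ∑ t ∈ agreeing T A s, ∑ r ∈ agreeing T B t, w t * c t := by
      refine Finset.sum_comm' fun t s => ?_
      simp only [mem_agreeing]
      grind
    _ = ∑ s ∈ T, ∑ r ∈ agreeing T (A ∩ B) s,
          ∑ t ∈ agreeing T A s with ∀ v ∈ B, t v = r v, w t * c t := by
      refine Finset.sum_congr rfl fun s _ => Finset.sum_comm' fun t r => ?_
      simp only [mem_agreeing, Finset.mem_filter, Finset.mem_inter]
      grind
    _ ≤ ∑ s ∈ T, ∑ r ∈ agreeing T (A ∩ B) s, c s := by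
      refine Finset.sum_le_sum fun s _ => Finset.sum_le_sum fun r _ => ?_
      have hc : ∀ t ∈ ({t ∈ agreeing T A s | ∀ v ∈ B, t v = r v} : Finset (V → D)),
          w t * c t = w t * c s := fun t ht => by
        have : agreeing T (A ∩ B) t = agreeing T (A ∩ B) s :=
          agreeing_congr fun v hv => (mem_agreeing.mp (Finset.mem_filter.mp ht).1).2 v
            (Finset.mem_inter.mp hv).1
        simp only [c, this]
      rw [Finset.sum_congr rfl hc, ← Finset.sum_mul]
      refine mul_le_of_le_one_left (by positivity) (sum_inv_card_agreeing_le_one ?_ ?_)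
      · intro t ht
        exact (mem_agreeing.mp (Finset.mem_filter.mp ht).1).1
      · simp only [Finset.mem_filter, mem_agreeing, Finset.mem_union]
        grind
    _ = T.card := by
      rw [Finset.card_eq_sum_ones, Nat.cast_sum]
      refine Finset.sum_congr rfl fun s hs => ?_
      rw [Finset.sum_const, nsmul_eq_mul, Nat.cast_one]
      exact mul_inv_cancel₀ (card_agreeing_pos hs).ne'

theorem residualEntropy_supermodular [DecidableEq V] (T : Finset (V → D)) (A B : Finset V) :
    residualEntropy T A + residualEntropy T B ≤
      residualEntropy T (A ∪ B) + residualEntropy T (A ∩ B) := by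
  simp only [residualEntropy, ← add_div, ← Finset.sum_add_distrib]
  refine div_le_div_of_nonneg_right ?_ (Nat.cast_nonneg _)
  rw [← sub_nonpos, ← Finset.sum_sub_distrib]
  calc
    _ ≤ ∑ t ∈ T, (((agreeing T A t).card * (agreeing T B t).card : ℝ) *
          (((agreeing T (A ∪ B) t).card : ℝ)⁻¹ * ((agreeing T (A ∩ B) t).card : ℝ)⁻¹) - 1) := by
      refine Finset.sum_le_sum fun t ht => ?_
      have h (C : Finset V) := card_agreeing_pos (A := C) ht
      have hA := h A
      have hB := h B
      have hU := h (A ∪ B)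
      have hI := h (A ∩ B)
      refine le_trans (le_of_eq ?_) (Real.log_le_sub_one_of_pos (by positivity))
      rw [Real.log_mul (by positivity) (by positivity), Real.log_mul hA.ne' hB.ne',
        Real.log_mul (by positivity) (by positivity), Real.log_inv, Real.log_inv]
      ring
    _ ≤ 0 := by
      have := sum_agreeing_ratio_le T A B
      simp only [Finset.sum_sub_distrib, Finset.sum_const, nsmul_eq_mul, mul_one]
      linarith

/-- The entropy of the restriction to `A` is at most the logarithm of the number of values. -/
theorem log_card_le_residualEntropy_add_log {α : Type} (hT : T.Nonempty) (f : (V → D) → α)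
    (P : Finset α) (hf : ∀ t ∈ T, f t ∈ P) (hA : ∀ s t, f s = f t → ∀ v ∈ A, s v = t v)
    {N : ℕ} (hP : P.card ≤ N) :
    Real.log (T.card : ℝ) ≤ residualEntropy T A + Real.log N := by
  have hc : (0 : ℝ) < T.card := by exact_mod_cast hT.card_pos
  have hN : (0 : ℝ) < N := by
    obtain ⟨t, ht⟩ := hT
    exact_mod_cast (Finset.card_pos.mpr ⟨f t, hf t ht⟩).trans_le hP
  have hsum : ∑ t ∈ T, ((agreeing T A t).card : ℝ)⁻¹ ≤ N :=
    (sum_inv_card_agreeing_le_card f P hf hA).trans (by exact_mod_cast hP)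
  have key : ∑ t ∈ T, (Real.log T.card - Real.log (agreeing T A t).card - Real.log N) ≤
      ∑ t ∈ T, ((T.card / N : ℝ) * ((agreeing T A t).card : ℝ)⁻¹ - 1) := by
    refine Finset.sum_le_sum fun t ht => ?_
    have ha := card_agreeing_pos (A := A) ht
    refine le_trans (le_of_eq ?_) (Real.log_le_sub_one_of_pos (by positivity))
    rw [Real.log_mul (by positivity) (by positivity), Real.log_div hc.ne' hN.ne', Real.log_inv]
    ring
  have hle : (T.card / N : ℝ) * ∑ t ∈ T, ((agreeing T A t).card : ℝ)⁻¹ ≤ T.card := by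
    calc
      _ ≤ (T.card / N : ℝ) * N := by gcongr
      _ = T.card := by field_simp
  simp only [Finset.sum_sub_distrib, ← Finset.mul_sum, Finset.sum_const, nsmul_eq_mul,
    mul_one] at key
  rw [residualEntropy, ← sub_le_iff_le_add, le_div_iff₀ hc]
  linarith

/-- The chain rule splits the logarithm of the size of `T` into weights of the attributes such
that two weights sum to at most the entropy of the corresponding pair of coordinates. -/
theorem exists_entropy_weights [Fintype V] [DecidableEq V] (hT : T.Nonempty) :
    ∃ u : V → ℝ, (∀ x, 0 ≤ u x) ∧ ∑ x, u x = Real.log (T.card : ℝ) ∧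
      ∀ x y, x ≠ y → u x + u y ≤ Real.log (T.card : ℝ) - residualEntropy T {x, y} := by
  let e := Fintype.equivFin V
  let I : ℕ → Finset V := fun k => {v | (e v : ℕ) < k}
  have hI (k : ℕ) (v : V) : v ∈ I k ↔ (e v : ℕ) < k := by simp [I]
  let u : V → ℝ := fun x => residualEntropy T (I (e x)) - residualEntropy T (I (e x + 1))
  have hlt (x y : V) (hxy : (e x : ℕ) < e y) :
      u x + u y ≤ Real.log (T.card : ℝ) - residualEntropy T {x, y} := by
    have h₁ := residualEntropy_supermodular T (I (e y)) {x, y}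
    have h₂ := residualEntropy_supermodular T (I (e x)) {x}
    have e₁ : I (e y) ∪ {x, y} = I (e y + 1) := by
      ext v
      have : v = y ↔ (e v : ℕ) = e y := by rw [← Fin.ext_iff, e.injective.eq_iff]
      simp only [Finset.mem_union, hI, Finset.mem_insert, Finset.mem_singleton]
      grind
    have e₂ : I (e y) ∩ {x, y} = {x} := by
      ext v
      simp only [Finset.mem_inter, hI, Finset.mem_insert, Finset.mem_singleton]
      grind
    have e₃ : I (e x) ∪ {x} = I (e x + 1) := by
      ext v
      have : v = x ↔ (e v : ℕ) = e x := by rw [← Fin.ext_iff, e.injective.eq_iff]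
      simp only [Finset.mem_union, hI, Finset.mem_singleton]
      grind
    have e₄ : I (e x) ∩ {x} = ∅ := by
      ext v
      simp only [Finset.mem_inter, hI, Finset.mem_singleton, Finset.notMem_empty]
      grind
    rw [e₁, e₂] at h₁
    rw [e₃, e₄, residualEntropy_empty hT] at h₂
    simp only [u]
    linarith
  refine ⟨u, fun x => sub_nonneg.mpr (residualEntropy_anti fun v hv => ?_), ?_, fun x y hxy => ?_⟩
  · rw [hI] at hv ⊢
    omega
  · have h₀ : I 0 = ∅ := by ext v; simp [hI]
    have h₁ : I (Fintype.card V) = Finset.univ := by ext v; simp [hI]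
    rw [← e.symm.sum_comp]
    simp only [u, Equiv.apply_symm_apply]
    rw [Fin.sum_univ_eq_sum_range
        (fun k => residualEntropy T (I k) - residualEntropy T (I (k + 1))),
      Finset.sum_range_sub', h₀, h₁, residualEntropy_empty hT, residualEntropy_univ, sub_zero]
  · rcases lt_or_gt_of_ne (fun h => hxy (e.injective (Fin.ext h)) : (e x : ℕ) ≠ e y) with h | h
    · exact hlt x y h
    · rw [add_comm, Finset.pair_comm]
      exact hlt y x h

end Entropy


/-- AGM bound for natural join queries over binary relations:
the number of output tuples is bounded by the supremum, over fractional
vertex packings `u` of the query graph, of `N ^ (∑ x, u x)`. -/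
theorem stmt_0 {V D : Type} [Fintype V] [DecidableEq V]
    (E : Finset (V × V)) (hE : ∀ e ∈ E, e.1 ≠ e.2)
    (hcov : ∀ v : V, ∃ e ∈ E, e.1 = v ∨ e.2 = v)
    (N : ℕ) (hN : 1 ≤ N)
    (R : V × V → Finset (D × D))
    (hR : ∀ e ∈ E, (R e).card ≤ N) :
    (({t : V → D | ∀ e ∈ E, (t e.1, t e.2) ∈ R e}).ncard : ℝ) ≤
      sSup {r : ℝ | ∃ u : V → ℝ,
        (∀ x, 0 ≤ u x ∧ u x ≤ 1) ∧
        (∀ e ∈ E, u e.1 + u e.2 ≤ 1) ∧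
        r = (N : ℝ) ^ (∑ x, u x)} := by
  have hN' : (1 : ℝ) ≤ N := by exact_mod_cast hN
  set Q := {t : V → D | ∀ e ∈ E, (t e.1, t e.2) ∈ R e}
  rcases Nat.eq_zero_or_pos Q.ncard with h0 | hpos
  · rw [h0, Nat.cast_zero]
    refine Real.sSup_nonneg ?_
    rintro r ⟨u, -, -, rfl⟩
    positivity
  have hfin : Q.Finite := Set.finite_of_ncard_pos hpos
  set T := hfin.toFinset
  have hcard : Q.ncard = T.card := Set.ncard_eq_toFinset_card Q hfin
  have hT : T.Nonempty := Finset.card_pos.mp (hcard ▸ hpos)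
  have hc : (0 : ℝ) < T.card := by exact_mod_cast hT.card_pos
  obtain ⟨w, hw0, hwsum, hwpair⟩ := exists_entropy_weights hT
  have hwE : ∀ e ∈ E, w e.1 + w e.2 ≤ Real.log N := fun e he => by
    have h₁ := hwpair e.1 e.2 (hE e he)
    have h₂ := log_card_le_residualEntropy_add_log (A := {e.1, e.2}) hT
      (fun t => (t e.1, t e.2)) (R e) (fun t ht => hfin.mem_toFinset.mp ht e he)
      (by simp) (hR e he)
    linarith
  have hw1 : ∀ x, w x ≤ Real.log N := fun x => by
    obtain ⟨e, he, rfl | rfl⟩ := hcov x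
    · linarith [hwE e he, hw0 e.2]
    · linarith [hwE e he, hw0 e.1]
  have hlog : 0 ≤ Real.log N := Real.log_nonneg hN'
  have hmul : ∀ x, Real.log N * (w x / Real.log N) = w x := fun x => by
    rcases hlog.eq_or_lt with h | h
    · rw [← h, zero_mul]
      exact le_antisymm (hw0 x) (h ▸ hw1 x)
    · field_simp
  rw [hcard]
  refine le_csSup ⟨(N : ℝ) ^ (Fintype.card V : ℝ), ?_⟩
    ⟨fun x => w x / Real.log N, fun x => ⟨div_nonneg (hw0 x) hlog, div_le_one_of_le₀ (hw1 x) hlog⟩,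
      fun e he => ?_, ?_⟩
  · rintro r ⟨u, hu, -, rfl⟩
    refine Real.rpow_le_rpow_of_exponent_le hN' ?_
    simpa using Finset.sum_le_sum fun x (_ : x ∈ Finset.univ) => (hu x).2
  · rw [← add_div]
    exact div_le_one_of_le₀ (hwE e he) hlog
  · rw [Real.rpow_def_of_pos (by linarith), Finset.mul_sum,
      Finset.sum_congr rfl fun x _ => hmul x, hwsum, Real.exp_log hc]
end

section
/- Let D be a type, N ≥ 1 a real number, V' a finite set, and T a finite set of functions V' → D with |T| ≤ N^{|V'|/2}. Let X ∈ V', let Y be an element not in V', and let R ⊆ D × D be a finite relation such that d_R(a) ≤ √N for every a ∈ D. Then the set T' of functions t' : V' ∪ {Y} → D such that the restriction of t' to V' lies in T and (t' X, t' Y) ∈ R satisfies |T'| ≤ N^{(|V'|+1)/2}. -/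
/-- A single light join: extending a set `T` of tuples on attributes `V'`
(of size at most `N ^ (|V'|/2)`) by one new attribute `Y` through a relation
`R` all of whose first-coordinate degrees are at most `√N` yields a set of
size at most `N ^ ((|V'|+1)/2)`. -/
theorem stmt_3 {α D : Type} [DecidableEq α] [DecidableEq D]
    (N : ℝ) (hN : 1 ≤ N) (V' : Finset α)
    (T : Set (↥V' → D)) (hTfin : T.Finite)
    (hT : (T.ncard : ℝ) ≤ N ^ ((V'.card : ℝ) / 2))
    (X Y : α) (hX : X ∈ V') (hY : Y ∉ V')
    (R : Finset (D × D))
    (hR : ∀ a : D, (((R.filter (fun p => p.1 = a)).card : ℝ)) ≤ Real.sqrt N) :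
    (({t' : ↥(insert Y V') → D |
        (fun x : ↥V' => t' ⟨x.1, Finset.mem_insert_of_mem x.2⟩) ∈ T ∧
        (t' ⟨X, Finset.mem_insert_of_mem hX⟩, t' ⟨Y, Finset.mem_insert_self Y V'⟩) ∈ R}).ncard : ℝ)
      ≤ N ^ (((V'.card : ℝ) + 1) / 2) := by
  set S := {t' : ↥(insert Y V') → D |
    (fun x : ↥V' => t' ⟨x.1, Finset.mem_insert_of_mem x.2⟩) ∈ T ∧
    (t' ⟨X, Finset.mem_insert_of_mem hX⟩, t' ⟨Y, Finset.mem_insert_self Y V'⟩) ∈ R} with hS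
  let fiber : (↥V' → D) → Finset (D × D) := fun t => R.filter (fun p => p.1 = t ⟨X, hX⟩)
  let f : (↥(insert Y V') → D) → (_ : ↥V' → D) × (D × D) := fun t' =>
    ⟨fun x => t' ⟨x.1, Finset.mem_insert_of_mem x.2⟩,
      (t' ⟨X, Finset.mem_insert_of_mem hX⟩, t' ⟨Y, Finset.mem_insert_self Y V'⟩)⟩
  have f_inj : Function.Injective f := by
    intro s t hst
    simp only [f, Sigma.mk.injEq, heq_eq_eq, Prod.mk.injEq] at hst
    obtain ⟨hV, -, hst_Y⟩ := hst
    funext ⟨x, hx⟩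
    rcases Finset.mem_insert.1 hx with rfl | hx'
    · exact hst_Y
    · exact congrFun hV ⟨x, hx'⟩
  have hcard : S.ncard ≤ (hTfin.toFinset.sigma fiber).card := by
    rw [← Set.ncard_coe_finset]
    refine Set.ncard_le_ncard_of_injOn f (fun t ht => ?_) f_inj.injOn (Finset.finite_toSet _)
    simpa [f, fiber, hS] using ht
  have hN0 : 0 < N := zero_lt_one.trans_le hN
  calc (S.ncard : ℝ) ≤ ((hTfin.toFinset.sigma fiber).card : ℝ) := by exact_mod_cast hcard
    _ = ∑ t ∈ hTfin.toFinset, ((fiber t).card : ℝ) := by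
      rw [Finset.card_sigma, Nat.cast_sum]
    _ ≤ ∑ _t ∈ hTfin.toFinset, √N := Finset.sum_le_sum fun t _ => hR _
    _ = T.ncard * √N := by
      rw [Finset.sum_const, nsmul_eq_mul, Set.ncard_eq_toFinset_card T hTfin]
    _ ≤ N ^ ((V'.card : ℝ) / 2) * √N := by gcongr
    _ = N ^ (((V'.card : ℝ) + 1) / 2) := by
      rw [Real.sqrt_eq_rpow, ← Real.rpow_add hN0, add_div]
end

section
/- Let D be a type and N ≥ 1 a real number. Suppose T₀ ⊆ D × D is a finite relation with |T₀| ≤ N, and for each i = 1,…,m the set T_i ⊆ D^{i+2} is defined by T_i = {(t, y) : t ∈ T_{i−1} and (t_{j_i}, y) ∈ R_i}, where j_i is some coordinate index of D^{i+1} and R_i ⊆ D × D is a finite relation all of whose first-coordinate degrees are at most √N. Then |T_m| ≤ N^{(m+2)/2}. -/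
/-- The extension of a finite set of tuples by a new last coordinate, matched through `R` at the
coordinate `j`, has at most `d` times as many tuples if the degrees of `R` are at most `d`. -/
theorem finite_and_ncard_lightJoin_le {D : Type*} [DecidableEq D] {n d : ℕ}
    {S : Set (Fin n → D)} (hS : S.Finite) (j : Fin n) (R : Finset (D × D))
    (hR : ∀ a, (R.filter (fun p => p.1 = a)).card ≤ d) :
    {t : Fin (n + 1) → D | (fun k : Fin n => t k.castSucc) ∈ S ∧
      (t j.castSucc, t (Fin.last n)) ∈ R}.Finite ∧
    {t : Fin (n + 1) → D | (fun k : Fin n => t k.castSucc) ∈ S ∧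
      (t j.castSucc, t (Fin.last n)) ∈ R}.ncard ≤ S.ncard * d := by
  let F : Finset (Fin (n + 1) → D) := hS.toFinset.biUnion fun t =>
    (R.filter (fun p => p.1 = t j)).image fun p => Fin.snoc (α := fun _ => D) t p.2
  have hsub : {t : Fin (n + 1) → D | (fun k : Fin n => t k.castSucc) ∈ S ∧
      (t j.castSucc, t (Fin.last n)) ∈ R} ⊆ F := by
    rintro t ⟨ht, hmem⟩
    simp only [F, Finset.coe_biUnion, Set.mem_iUnion, Finset.mem_coe, Set.Finite.mem_toFinset,
      Finset.mem_image, Finset.mem_filter]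
    exact ⟨_, ht, _, ⟨hmem, rfl⟩, Fin.snoc_init_self t⟩
  refine ⟨F.finite_toSet.subset hsub, ?_⟩
  calc _ ≤ (F : Set (Fin (n + 1) → D)).ncard := Set.ncard_le_ncard hsub F.finite_toSet
    _ = F.card := Set.ncard_coe_finset F
    _ ≤ hS.toFinset.card * d :=
      Finset.card_biUnion_le_card_mul _ _ _ fun t _ => Finset.card_image_le.trans (hR (t j))
    _ = S.ncard * d := by rw [Set.ncard_eq_toFinset_card S hS]

/-- A finite relation, viewed as a set of functions on `Fin 2`, is finite with the same number of
elements. -/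
theorem finite_and_ncard_finTwo {D : Type*} (R : Finset (D × D)) :
    {t : Fin 2 → D | (t 0, t 1) ∈ R}.Finite ∧
    {t : Fin 2 → D | (t 0, t 1) ∈ R}.ncard = R.card := by
  have h : {t : Fin 2 → D | (t 0, t 1) ∈ R} = (finTwoArrowEquiv D).symm '' (R : Set (D × D)) := by
    rw [Equiv.image_symm_eq_preimage]
    rfl
  rw [h]
  exact ⟨R.finite_toSet.image _, by
    rw [Set.ncard_image_of_injective _ (Equiv.injective _), Set.ncard_coe_finset]⟩

/-- A chain of light joins starting from a relation of size at most `N` and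
performing `m` light-join extension steps produces an intermediate result of
size at most `N ^ ((m+2)/2)`. -/
theorem stmt_4 {D : Type} [DecidableEq D] (N : ℝ) (hN : 1 ≤ N) (m : ℕ)
    (T0 : Finset (D × D)) (hT0card : (T0.card : ℝ) ≤ N)
    (T : (i : ℕ) → Set (Fin (i + 2) → D))
    (hT0 : T 0 = {t | (t 0, t 1) ∈ T0})
    (j : (i : ℕ) → Fin (i + 2))
    (R : ℕ → Finset (D × D))
    (hlight : ∀ i < m, ∀ a : D,
      ((((R i).filter (fun p => p.1 = a)).card : ℝ)) ≤ Real.sqrt N)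
    (hstep : ∀ i < m, T (i + 1) =
      {t : Fin (i + 3) → D |
        (fun k : Fin (i + 2) => t k.castSucc) ∈ T i ∧
        (t (j i).castSucc, t (Fin.last (i + 2))) ∈ R i}) :
    ((T m).ncard : ℝ) ≤ N ^ (((m : ℝ) + 2) / 2) := by
  have key : ∀ i ≤ m, (T i).Finite ∧ ((T i).ncard : ℝ) ≤ N ^ (((i : ℝ) + 2) / 2) := by
    intro i
    induction i with
    | zero =>
      intro _
      rw [hT0]
      obtain ⟨hfin, hcard⟩ := finite_and_ncard_finTwo T0
      refine ⟨hfin, ?_⟩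
      have hexp : (((0 : ℕ) : ℝ) + 2) / 2 = 1 := by norm_num
      rw [hexp, Real.rpow_one]
      exact (congrArg (Nat.cast (R := ℝ)) hcard).trans_le hT0card
    | succ i ih =>
      intro hi
      obtain ⟨hfin, hcard⟩ := ih (by omega)
      rw [hstep i hi]
      obtain ⟨hfin', hcard'⟩ := finite_and_ncard_lightJoin_le (d := ⌊Real.sqrt N⌋₊) hfin (j i) (R i)
        fun a => Nat.le_floor (hlight i hi a)
      refine ⟨hfin', ?_⟩
      calc _ ≤ (((T i).ncard * ⌊Real.sqrt N⌋₊ : ℕ) : ℝ) := Nat.cast_le.mpr hcard'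
        _ = ((T i).ncard : ℝ) * (⌊Real.sqrt N⌋₊ : ℝ) := Nat.cast_mul _ _
        _ ≤ N ^ (((i : ℝ) + 2) / 2) * Real.sqrt N := by
          gcongr
          exact Nat.floor_le (Real.sqrt_nonneg N)
        _ = N ^ ((((i + 1 : ℕ) : ℝ) + 2) / 2) := by
          rw [Real.sqrt_eq_rpow, ← Real.rpow_add (by linarith)]
          push_cast
          ring_nf
  exact (key m le_rfl).2
end

section
/- Let V be a finite set, E a finite set of ordered pairs (x,y) of distinct elements of V such that every element of V occurs in at least one edge, D a type, N ≥ 1 a natural number, and for each e ∈ E a finite relation R_e ⊆ D × D with |R_e| ≤ N. Let U ⊆ V satisfy: (1) every y ∈ V \ U is the second component of at least one edge (x,y) ∈ E with x ∈ U; and (2) every edge of E with exactly one endpoint in U has its first component in U, and its relation has all of its first-coordinate degrees at most √N. Let T be the set of maps t : V → D satisfying (t x, t y) ∈ R_{(x,y)} for every edge (x,y) ∈ E whose first component x lies in U (i.e., T enforces all edges inside U and all edges from U into V \ U, but no edges inside V \ U). Then |T| is at most the supremum, over all fractional vertex packings u of the query graph (V,E), of N^{∑_{x∈V} u x}. -/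
/-- The number of elements of `T` carrying the same label as `t`. -/
noncomputable def fiberCard {Ω α : Type*} (T : Finset Ω) (k : Ω → α) (t : Ω) : ℕ :=
  open Classical in (T.filter (fun s => k s = k t)).card

/-- The sum of the logarithms of the fiber sizes of a labelling `k` of `T`. If `X` is uniform on
`T`, the entropy of `k X` is `log |T| - logFiberSum T k / |T|`. -/
noncomputable def logFiberSum {Ω α : Type*} (T : Finset Ω) (k : Ω → α) : ℝ :=
  ∑ t ∈ T, Real.log (fiberCard T k t)

section FiberEntropy

variable {Ω α β γ : Type*} {T : Finset Ω}

lemma fiberCard_eq_card_filter [DecidableEq α] (k : Ω → α) (t : Ω) :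
    fiberCard T k t = (T.filter (fun s => k s = k t)).card := by
  rw [fiberCard]
  congr

lemma fiberCard_pos (k : Ω → α) {t : Ω} (ht : t ∈ T) : 0 < fiberCard T k t := by
  classical
  exact Finset.card_pos.2 ⟨t, by simp [ht]⟩

lemma fiberCard_congr {a : Ω → α} {b : Ω → β} {t : Ω}
    (h : ∀ s ∈ T, a s = a t ↔ b s = b t) : fiberCard T a t = fiberCard T b t := by
  classical
  unfold fiberCard
  congr 1
  exact Finset.filter_congr h

lemma logFiberSum_congr {a : Ω → α} {b : Ω → β}
    (h : ∀ s ∈ T, ∀ t ∈ T, a s = a t ↔ b s = b t) : logFiberSum T a = logFiberSum T b :=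
  Finset.sum_congr rfl fun t ht => by rw [fiberCard_congr fun s hs => h s hs t ht]

lemma logFiberSum_anti {a : Ω → α} {b : Ω → β}
    (h : ∀ s ∈ T, ∀ t ∈ T, a s = a t → b s = b t) : logFiberSum T a ≤ logFiberSum T b := by
  classical
  refine Finset.sum_le_sum fun t ht => Real.log_le_log
    (by exact_mod_cast fiberCard_pos a ht) ?_
  exact_mod_cast Finset.card_le_card fun s hs => by
    simp only [Finset.mem_filter] at hs ⊢
    exact ⟨hs.1, h s hs.1 t ht hs.2⟩

lemma logFiberSum_const (T : Finset Ω) :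
    logFiberSum T (fun _ => ()) = T.card * Real.log T.card := by
  simp [logFiberSum, fiberCard]

lemma logFiberSum_of_injOn {k : Ω → α} (h : Set.InjOn k T) : logFiberSum T k = 0 := by
  classical
  refine Finset.sum_eq_zero fun t ht => ?_
  have : T.filter (fun s => k s = k t) = {t} := by
    ext s
    simp only [Finset.mem_filter, Finset.mem_singleton]
    exact ⟨fun hs => h hs.1 ht hs.2, fun hs => by simp [hs, ht]⟩
  rw [fiberCard_eq_card_filter, this, Finset.card_singleton, Nat.cast_one, Real.log_one]

lemma sum_inv_fiberCard_le_one [DecidableEq α] (k : Ω → α) (x : α) :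
    ∑ t ∈ T.filter (fun t => k t = x), (fiberCard T k t : ℝ)⁻¹ ≤ 1 := by
  have h : ∀ t ∈ T.filter (fun t => k t = x), (fiberCard T k t : ℝ)⁻¹
      = ((T.filter (fun t => k t = x)).card : ℝ)⁻¹ := by
    intro t ht
    rw [← (Finset.mem_filter.1 ht).2, fiberCard_eq_card_filter]
  rw [Finset.sum_congr rfl h, Finset.sum_const, nsmul_eq_mul]
  exact mul_inv_le_one

lemma sum_log_le_card_mul_log {Z : Ω → ℝ} {M : ℝ} (hM : 0 < M) (hZ : ∀ t ∈ T, 0 < Z t)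
    (h : ∑ t ∈ T, Z t ≤ T.card * M) : ∑ t ∈ T, Real.log (Z t) ≤ T.card * Real.log M := by
  have h1 : ∀ t ∈ T, Real.log (Z t) ≤ Real.log M + (Z t / M - 1) := by
    intro t ht
    have := Real.log_le_sub_one_of_pos (div_pos (hZ t ht) hM)
    rw [Real.log_div (hZ t ht).ne' hM.ne'] at this
    linarith
  have h2 : (∑ t ∈ T, Z t) / M ≤ T.card := (div_le_iff₀ hM).2 h
  refine (Finset.sum_le_sum h1).trans ?_
  rw [Finset.sum_add_distrib, Finset.sum_sub_distrib, ← Finset.sum_div]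
  simp only [Finset.sum_const, nsmul_eq_mul, mul_one]
  linarith

/-- The conditional entropy of `k` given `c` is at most the logarithm of the largest number of
values of `k` on a fiber of `c`. -/
lemma logFiberSum_sub_le [DecidableEq α] [DecidableEq γ] {c : Ω → γ} {k : Ω → α} {M : ℝ} (hM : 0 < M)
    (h : ∀ s ∈ T, (((T.filter (fun t => c t = c s)).image k).card : ℝ) ≤ M) :
    logFiberSum T c - logFiberSum T k ≤ T.card * Real.log M := by
  have hc : ∀ t ∈ T, (0 : ℝ) < fiberCard T c t :=
    fun t ht => by exact_mod_cast fiberCard_pos c ht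
  have hk : ∀ t ∈ T, (0 : ℝ) < fiberCard T k t :=
    fun t ht => by exact_mod_cast fiberCard_pos k ht
  have key : ∑ t ∈ T, (fiberCard T c t : ℝ) / fiberCard T k t ≤ T.card * M := by
    calc ∑ t ∈ T, (fiberCard T c t : ℝ) / fiberCard T k t
        = ∑ t ∈ T, ∑ s ∈ T, if c t = c s then (fiberCard T k t : ℝ)⁻¹ else 0 := by
          refine Finset.sum_congr rfl fun t _ => ?_
          rw [← Finset.sum_filter, Finset.sum_const, nsmul_eq_mul, div_eq_mul_inv,
            fiberCard_eq_card_filter]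
          simp only [eq_comm]
      _ = ∑ s ∈ T, ∑ t ∈ T.filter (fun t => c t = c s), (fiberCard T k t : ℝ)⁻¹ := by
          rw [Finset.sum_comm]
          simp only [Finset.sum_filter]
      _ ≤ ∑ s ∈ T, M := by
          refine Finset.sum_le_sum fun s hs => le_trans ?_ (h s hs)
          rw [← Finset.sum_fiberwise_of_maps_to
            (fun t ht => Finset.mem_image_of_mem k ht)]
          refine (Finset.sum_le_card_nsmul _ _ 1 fun x _ => ?_).trans (by simp)
          refine le_trans ?_ (sum_inv_fiberCard_le_one (T := T) k x)
          refine Finset.sum_le_sum_of_subset_of_nonneg ?_ fun _ _ _ => by positivity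
          exact Finset.filter_subset_filter _ (Finset.filter_subset _ _)
      _ = T.card * M := by simp
  have := sum_log_le_card_mul_log hM (fun t ht => div_pos (hc t ht) (hk t ht)) key
  rwa [Finset.sum_congr rfl fun t ht => Real.log_div (hc t ht).ne' (hk t ht).ne',
    Finset.sum_sub_distrib] at this

/-- Conditioning on a finer labelling decreases conditional entropy. -/
lemma logFiberSum_sub_prod_le {a : Ω → α} {b : Ω → β} {c : Ω → γ}
    (h : ∀ s ∈ T, ∀ t ∈ T, a s = a t → c s = c t) :
    logFiberSum T a - logFiberSum T (fun t => (a t, b t)) ≤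
      logFiberSum T c - logFiberSum T (fun t => (c t, b t)) := by
  classical
  set ab := fun t => (a t, b t) with hab
  set cb := fun t => (c t, b t) with hcb
  have pa : ∀ t ∈ T, (0 : ℝ) < fiberCard T a t :=
    fun t ht => by exact_mod_cast fiberCard_pos a ht
  have pc : ∀ t ∈ T, (0 : ℝ) < fiberCard T c t :=
    fun t ht => by exact_mod_cast fiberCard_pos c ht
  have pab : ∀ t ∈ T, (0 : ℝ) < fiberCard T ab t :=
    fun t ht => by exact_mod_cast fiberCard_pos ab ht
  have pcb : ∀ t ∈ T, (0 : ℝ) < fiberCard T cb t :=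
    fun t ht => by exact_mod_cast fiberCard_pos cb ht
  have inner : ∀ s ∈ T, ∑ t ∈ T.filter (fun t => a t = a s),
      (fiberCard T cb t : ℝ) / fiberCard T ab t ≤ fiberCard T c s := by
    intro s hs
    calc ∑ t ∈ T.filter (fun t => a t = a s), (fiberCard T cb t : ℝ) / fiberCard T ab t
        = ∑ t ∈ T.filter (fun t => a t = a s), ∑ r ∈ T.filter (fun r => c r = c s),
            if b t = b r then (fiberCard T ab t : ℝ)⁻¹ else 0 := by
          refine Finset.sum_congr rfl fun t ht => ?_
          obtain ⟨ht, hts⟩ := Finset.mem_filter.1 ht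
          rw [← Finset.sum_filter, Finset.sum_const, nsmul_eq_mul, div_eq_mul_inv,
            fiberCard_eq_card_filter, Finset.filter_filter]
          congr 3
          refine Finset.filter_congr fun r _ => ?_
          rw [hcb, Prod.mk.injEq, h t ht s hs hts, eq_comm (a := b r)]
      _ = ∑ r ∈ T.filter (fun r => c r = c s),
            ∑ t ∈ T.filter (fun t => ab t = (a s, b r)), (fiberCard T ab t : ℝ)⁻¹ := by
          rw [Finset.sum_comm]
          refine Finset.sum_congr rfl fun r _ => ?_
          rw [← Finset.sum_filter, Finset.filter_filter]
          simp only [hab, Prod.mk.injEq]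
      _ ≤ ∑ r ∈ T.filter (fun r => c r = c s), 1 :=
          Finset.sum_le_sum fun r _ => sum_inv_fiberCard_le_one ab _
      _ = fiberCard T c s := by simp [fiberCard_eq_card_filter]
  have key : ∑ t ∈ T, (fiberCard T a t : ℝ) * fiberCard T cb t /
      (fiberCard T ab t * fiberCard T c t) ≤ T.card * 1 := by
    calc ∑ t ∈ T, (fiberCard T a t : ℝ) * fiberCard T cb t /
          (fiberCard T ab t * fiberCard T c t)
        = ∑ t ∈ T, ∑ s ∈ T, if a t = a s then
            (fiberCard T cb t : ℝ) / fiberCard T ab t / fiberCard T c t else 0 := by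
          refine Finset.sum_congr rfl fun t _ => ?_
          rw [← Finset.sum_filter, Finset.sum_const, nsmul_eq_mul, div_div, ← mul_div_assoc,
            fiberCard_eq_card_filter]
          simp only [eq_comm]
      _ = ∑ s ∈ T, (∑ t ∈ T.filter (fun t => a t = a s),
            (fiberCard T cb t : ℝ) / fiberCard T ab t) / fiberCard T c s := by
          rw [Finset.sum_comm]
          refine Finset.sum_congr rfl fun s hs => ?_
          rw [← Finset.sum_filter, Finset.sum_div]
          refine Finset.sum_congr rfl fun t ht => ?_
          obtain ⟨ht, hts⟩ := Finset.mem_filter.1 ht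
          rw [fiberCard_eq_card_filter c t, fiberCard_eq_card_filter c s, h t ht s hs hts]
      _ ≤ ∑ s ∈ T, (1 : ℝ) :=
          Finset.sum_le_sum fun s hs => (div_le_one (pc s hs)).2 (inner s hs)
      _ = T.card * 1 := by simp
  have := sum_log_le_card_mul_log one_pos (fun t ht => div_pos
    (mul_pos (pa t ht) (pcb t ht)) (mul_pos (pab t ht) (pc t ht))) key
  rw [Finset.sum_congr rfl fun t ht => by
    rw [Real.log_div (mul_pos (pa t ht) (pcb t ht)).ne' (mul_pos (pab t ht) (pc t ht)).ne',
      Real.log_mul (pa t ht).ne' (pcb t ht).ne', Real.log_mul (pab t ht).ne' (pc t ht).ne'],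
    Finset.sum_sub_distrib, Finset.sum_add_distrib, Finset.sum_add_distrib] at this
  simp only [Real.log_one, mul_zero] at this
  simp only [logFiberSum]
  linarith

end FiberEntropy

/-- The restriction of a tuple to the attributes of rank less than `n`. -/
def restrictBelow {V D : Type*} (r : V → ℕ) (n : ℕ) (t : V → D) : {w // r w < n} → D :=
  fun w => t w

/-- The increment `|T| * H(v | attributes of smaller rank)` of the chain rule for the uniform
distribution on `T`. -/
noncomputable def chainIncrement {V D : Type*} (T : Finset (V → D)) (r : V → ℕ) (v : V) : ℝ :=
  logFiberSum T (restrictBelow r (r v)) - logFiberSum T (restrictBelow r (r v + 1))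

section ChainRule

variable {V D : Type*} {T : Finset (V → D)} {r : V → ℕ}

lemma restrictBelow_eq_iff {n : ℕ} {s t : V → D} :
    restrictBelow r n s = restrictBelow r n t ↔ ∀ w, r w < n → s w = t w := by
  simp [restrictBelow, funext_iff]

lemma chainIncrement_nonneg (v : V) : 0 ≤ chainIncrement T r v := by
  refine sub_nonneg.2 (logFiberSum_anti fun s _ t _ h => ?_)
  rw [restrictBelow_eq_iff] at h ⊢
  exact fun w hw => h w (by omega)

lemma chainIncrement_le {γ : Type*} (hr : Function.Injective r) (v : V) {c : (V → D) → γ}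
    (h : ∀ s t : V → D, (∀ w, r w < r v → s w = t w) → c s = c t) :
    chainIncrement T r v ≤ logFiberSum T c - logFiberSum T (fun t => (c t, t v)) := by
  have h1 : logFiberSum T (restrictBelow r (r v + 1)) =
      logFiberSum T (fun t => (restrictBelow r (r v) t, t v)) := by
    refine logFiberSum_congr fun s _ t _ => ?_
    rw [Prod.mk.injEq, restrictBelow_eq_iff, restrictBelow_eq_iff]
    refine ⟨fun h => ⟨fun w hw => h w (by omega), h v (by omega)⟩, fun h w hw => ?_⟩
    rcases Nat.lt_succ_iff_lt_or_eq.1 hw with hw | hw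
    · exact h.1 w hw
    · rw [hr hw]
      exact h.2
  rw [chainIncrement, h1]
  exact logFiberSum_sub_prod_le fun s _ t _ hst => h s t (restrictBelow_eq_iff.1 hst)

lemma chainIncrement_add_le_of_lt (hr : Function.Injective r) {x y : V} (hxy : r x < r y) :
    chainIncrement T r x + chainIncrement T r y ≤
      logFiberSum T (fun _ => ()) - logFiberSum T (fun t => (t x, t y)) := by
  have h1 := chainIncrement_le (T := T) hr x (c := fun _ => ()) (fun _ _ _ => rfl)
  have h2 := chainIncrement_le (T := T) hr y (c := fun t => t x) (fun _ _ h => h x hxy)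
  have h3 : logFiberSum T (fun t => ((), t x)) = logFiberSum T (fun t => t x) :=
    logFiberSum_congr fun s _ t _ => by simp
  linarith

lemma chainIncrement_add_le (hr : Function.Injective r) {x y : V} (hxy : x ≠ y) :
    chainIncrement T r x + chainIncrement T r y ≤
      logFiberSum T (fun _ => ()) - logFiberSum T (fun t => (t x, t y)) := by
  rcases lt_or_gt_of_ne (hr.ne hxy) with h | h
  · exact chainIncrement_add_le_of_lt hr h
  · rw [add_comm, logFiberSum_congr (a := fun t : V → D => (t x, t y))
      (b := fun t : V → D => (t y, t x)) fun s _ t _ => by simp [and_comm]]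
    exact chainIncrement_add_le_of_lt hr h

lemma sum_chainIncrement [Fintype V] (hr : Function.Injective r) :
    ∑ v, chainIncrement T r v = T.card * Real.log T.card := by
  classical
  obtain ⟨n, hn⟩ : ∃ n, ∀ v, r v < n :=
    ⟨Finset.univ.sup r + 1, fun v => Nat.lt_succ_of_le (Finset.le_sup (Finset.mem_univ v))⟩
  have h0 : logFiberSum T (restrictBelow r 0) = T.card * Real.log T.card := by
    rw [← logFiberSum_const]
    exact logFiberSum_congr fun s _ t _ => by simp [restrictBelow_eq_iff]
  have h1 : logFiberSum T (restrictBelow r n) = 0 :=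
    logFiberSum_of_injOn fun s _ t _ h => funext fun w => restrictBelow_eq_iff.1 h w (hn w)
  calc ∑ v, chainIncrement T r v
      = ∑ k ∈ Finset.univ.image r,
          (logFiberSum T (restrictBelow r k) - logFiberSum T (restrictBelow r (k + 1))) := by
        rw [Finset.sum_image fun _ _ _ _ h => hr h]
        rfl
    _ = ∑ k ∈ Finset.range n,
          (logFiberSum T (restrictBelow r k) - logFiberSum T (restrictBelow r (k + 1))) := by
        refine Finset.sum_subset (fun k hk => ?_) fun k _ hk => ?_
        · obtain ⟨v, -, rfl⟩ := Finset.mem_image.1 hk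
          exact Finset.mem_range.2 (hn v)
        · refine sub_eq_zero.2 (logFiberSum_congr fun s _ t _ => ?_)
          rw [restrictBelow_eq_iff, restrictBelow_eq_iff]
          refine forall_congr' fun w => imp_congr_left ?_
          have : r w ≠ k := fun h => hk (Finset.mem_image.2 ⟨w, Finset.mem_univ w, h⟩)
          omega
    _ = T.card * Real.log T.card := by
        rw [Finset.sum_range_sub', h0, h1, sub_zero]

end ChainRule

/-- A finite type can be ranked injectively with the members of `U` first. -/
lemma exists_injective_rank {V : Type*} [Fintype V] (U : Finset V) :
    ∃ r : V → ℕ, Function.Injective r ∧ ∀ x ∈ U, ∀ y ∉ U, r x < r y := by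
  classical
  let e := Fintype.equivFin V
  refine ⟨fun v => if v ∈ U then e v else Fintype.card V + e v, fun x y h => ?_,
    fun x hx y hy => ?_⟩
  · have hx := (e x).2
    have hy := (e y).2
    refine e.injective (Fin.ext ?_)
    dsimp only at h
    split_ifs at h <;> omega
  · have := (e x).2
    simp only [hx, hy, if_true, if_false]
    omega


/-- The merge-step bound: if every attribute outside `U` is reached by a light
edge from `U`, every crossing edge is directed out of `U` and is light in its
first attribute, then the intermediate result enforcing all edges whose first
component lies in `U` has size at most the AGM bound of the query. -/
theorem stmt_13 {V D : Type} [Fintype V] [DecidableEq V] [DecidableEq D]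
    (E : Finset (V × V)) (hE : ∀ e ∈ E, e.1 ≠ e.2)
    (hcov : ∀ v : V, ∃ e ∈ E, e.1 = v ∨ e.2 = v)
    (N : ℕ) (hN : 1 ≤ N)
    (R : V × V → Finset (D × D)) (hR : ∀ e ∈ E, (R e).card ≤ N)
    (U : Finset V)
    (h1 : ∀ y : V, y ∉ U → ∃ e ∈ E, e.2 = y ∧ e.1 ∈ U)
    (h2 : ∀ e ∈ E, ((e.1 ∈ U ∧ e.2 ∉ U) ∨ (e.1 ∉ U ∧ e.2 ∈ U)) →
      e.1 ∈ U ∧ ∀ a : D, ((((R e).filter (fun p => p.1 = a)).card : ℝ)) ≤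
        Real.sqrt N) :
    (({t : V → D | ∀ e ∈ E, e.1 ∈ U → (t e.1, t e.2) ∈ R e}).ncard : ℝ) ≤
      sSup {r : ℝ | ∃ u : V → ℝ,
        (∀ x, 0 ≤ u x ∧ u x ≤ 1) ∧
        (∀ e ∈ E, u e.1 + u e.2 ≤ 1) ∧
        r = (N : ℝ) ^ (∑ x, u x)} := by
  classical
  set S := {t : V → D | ∀ e ∈ E, e.1 ∈ U → (t e.1, t e.2) ∈ R e} with hS
  have hN0 : (0 : ℝ) < N := by exact_mod_cast hN
  have hN1 : (1 : ℝ) ≤ N := by exact_mod_cast hN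
  rcases Nat.eq_zero_or_pos S.ncard with hS0 | hSpos
  · rw [hS0, Nat.cast_zero]
    refine Real.sSup_nonneg ?_
    rintro _ ⟨u, -, -, rfl⟩
    positivity
  have hfin : S.Finite := Set.finite_of_ncard_pos hSpos
  obtain ⟨T, hT⟩ := hfin.exists_finset_coe
  have hmem : ∀ t ∈ T, ∀ e ∈ E, e.1 ∈ U → (t e.1, t e.2) ∈ R e := fun t ht => by
    have : t ∈ S := hT ▸ Finset.mem_coe.2 ht
    exact this
  rw [← hT, Set.ncard_coe_finset] at hSpos ⊢
  have hT0 : (0 : ℝ) < T.card := by exact_mod_cast hSpos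
  obtain ⟨r, hr, hrU⟩ := exists_injective_rank U
  have hlog : 0 ≤ Real.log N := Real.log_nonneg hN1
  have hlight : ∀ y ∉ U, chainIncrement T r y ≤ T.card * (Real.log N / 2) := by
    intro y hy
    obtain ⟨e, he, rfl, hx⟩ := h1 y hy
    refine (chainIncrement_le hr e.2 (c := fun t => t e.1)
      fun s t h => h e.1 (hrU _ hx _ hy)).trans ?_
    rw [← Real.log_sqrt hN0.le]
    refine logFiberSum_sub_le (Real.sqrt_pos.2 hN0) fun s _ =>
      le_trans ?_ ((h2 e he (Or.inl ⟨hx, hy⟩)).2 (s e.1))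
    norm_cast
    refine Finset.card_le_card (Finset.image_subset_iff.2 fun t ht => ?_)
    obtain ⟨ht, hts⟩ := Finset.mem_filter.1 ht
    exact Finset.mem_filter.2 ⟨hmem t ht e he hx, hts⟩
  have hedge : ∀ e ∈ E,
      chainIncrement T r e.1 + chainIncrement T r e.2 ≤ T.card * Real.log N := by
    intro e he
    by_cases hx : e.1 ∈ U
    · refine (chainIncrement_add_le hr (hE e he)).trans (logFiberSum_sub_le hN0 fun s _ => ?_)
      refine le_trans ?_ (Nat.cast_le.2 (hR e he))
      norm_cast
      refine Finset.card_le_card (Finset.image_subset_iff.2 fun t ht => ?_)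
      exact hmem t (Finset.mem_filter.1 ht).1 e he hx
    · have hy : e.2 ∉ U := fun hy => hx (h2 e he (Or.inr ⟨hx, hy⟩)).1
      linarith [hlight _ hx, hlight _ hy]
  have hvert : ∀ v, chainIncrement T r v ≤ T.card * Real.log N := by
    intro v
    obtain ⟨e, he, rfl | rfl⟩ := hcov v
    · linarith [hedge e he, chainIncrement_nonneg (T := T) (r := r) e.2]
    · linarith [hedge e he, chainIncrement_nonneg (T := T) (r := r) e.1]
  refine le_csSup ⟨(N : ℝ) ^ (∑ _x : V, (1 : ℝ)), ?_⟩
    ⟨fun v => chainIncrement T r v / (T.card * Real.log N), fun v => ⟨?_, ?_⟩, fun e he => ?_, ?_⟩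
  · rintro _ ⟨u, hu, -, rfl⟩
    exact Real.rpow_le_rpow_of_exponent_le hN1 (Finset.sum_le_sum fun x _ => (hu x).2)
  · exact div_nonneg (chainIncrement_nonneg v) (by positivity)
  · exact div_le_one_of_le₀ (hvert v) (by positivity)
  · rw [← add_div]
    exact div_le_one_of_le₀ (hedge e he) (by positivity)
  · rw [← Finset.sum_div, sum_chainIncrement hr, mul_div_mul_left _ _ hT0.ne',
      Real.rpow_def_of_pos hN0]
    rcases hlog.eq_or_lt with h | h
    · have hz : ∑ v, chainIncrement T r v ≤ 0 :=
        Finset.sum_nonpos fun v _ => by simpa [← h] using hvert v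
      rw [sum_chainIncrement hr] at hz
      have hc : Real.log T.card ≤ 0 := nonpos_of_mul_nonpos_right hz hT0
      have hc' : (0 : ℝ) ≤ Real.log T.card := Real.log_natCast_nonneg _
      rw [← h, zero_mul, ← le_antisymm hc hc', Real.exp_log hT0]
    · rw [mul_div_cancel₀ _ h.ne', Real.exp_log hT0]
end

section
/- Let D be a type, N ≥ 1 a real number, and R, S ⊆ D × D finite relations with |R| ≤ N. Let S_L = {(b,c) ∈ S : d_S(b) ≤ √N} be the light part of S. Then the number of pairs ((a,b),(b',c)) ∈ R × S_L with b = b' is at most N^{3/2}. -/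
/-- The join of `R` with the part of `S` whose first coordinates have degree at most `t`
has at most `#R * t` elements. -/
theorem card_join_light_le {A B C : Type*} [DecidableEq A] [DecidableEq B] {t : ℝ} (ht : 0 ≤ t)
    (R : Finset (A × B)) (S : Finset (B × C)) :
    ((((R ×ˢ (S.filter (fun q => ((S.filter (fun p => p.1 = q.1)).card : ℝ) ≤ t))).filter
        (fun q => q.1.2 = q.2.1)).card : ℝ)) ≤ R.card * t := by
  have h_card := Finset.card_le_mul_card_image_of_maps_to
    (s := (R ×ˢ (S.filter (fun q => ((S.filter (fun p => p.1 = q.1)).card : ℝ) ≤ t))).filter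
        (fun q => q.1.2 = q.2.1)) (t := R) (f := Prod.fst)
    (fun q hq => (Finset.mem_product.1 (Finset.mem_filter.1 hq).1).1) ⌊t⌋₊ ?_
  · calc
      _ ≤ ((⌊t⌋₊ * R.card : ℕ) : ℝ) := by exact_mod_cast h_card
      _ = R.card * (⌊t⌋₊ : ℝ) := by push_cast; ring
      _ ≤ R.card * t := by gcongr; exact Nat.floor_le ht
  · intro r _
    obtain h_empty | ⟨q, hq⟩ := Finset.eq_empty_or_nonempty
      (((R ×ˢ (S.filter (fun q => ((S.filter (fun p => p.1 = q.1)).card : ℝ) ≤ t))).filter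
        (fun q => q.1.2 = q.2.1)).filter (fun q => q.1 = r))
    · simp [h_empty]
    · simp only [Finset.mem_filter, Finset.mem_product] at hq
      obtain ⟨⟨⟨-, -, h_light⟩, h_eq⟩, rfl⟩ := hq
      refine le_trans (Finset.card_le_card_of_injOn Prod.snd ?_ ?_) (Nat.le_floor h_light)
      · intro p hp
        simp only [Finset.coe_filter, Finset.mem_filter, Finset.mem_product,
          Set.mem_ofPred_eq] at hp ⊢
        exact ⟨hp.1.1.2.1, by rw [← hp.1.2, hp.2, h_eq]⟩
      · intro p hp u hu h
        exact Prod.ext ((Finset.mem_filter.1 hp).2.trans (Finset.mem_filter.1 hu).2.symm) h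

/-- The intermediate result `R ⋈ S_L` of the split-based triangle plan, where
`S_L` is the light part of `S` at threshold `√N`, has at most `N^(3/2)`
tuples. -/
theorem stmt_16 {D : Type} [DecidableEq D] (N : ℝ) (hN : 1 ≤ N)
    (R S : Finset (D × D)) (hR : (R.card : ℝ) ≤ N) :
    ((((R ×ˢ (S.filter (fun q =>
        ((S.filter (fun p => p.1 = q.1)).card : ℝ) ≤ Real.sqrt N))).filter
        (fun q => q.1.2 = q.2.1)).card : ℝ)) ≤ N ^ ((3 : ℝ) / 2) := by
  calc
    _ ≤ R.card * Real.sqrt N := card_join_light_le (Real.sqrt_nonneg N) R S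
    _ ≤ N * Real.sqrt N := by gcongr
    _ = N ^ ((3 : ℝ) / 2) := by
      rw [Real.sqrt_eq_rpow, ← Real.rpow_one_add' (by linarith) (by norm_num)]
      norm_num
end

section
/- Let D be a type, N ≥ 1 a real number, and S, T ⊆ D × D finite relations with |S| ≤ N and |T| ≤ N. Let S_H = {(b,c) ∈ S : d_S(b) > √N} be the heavy part of S. Then the number of pairs ((b,c),(c',a)) ∈ S_H × T with c = c' is at most N^{3/2}. -/
/-- A join of two binary relations on the shared middle coordinate is determined by the first
coordinate of the left tuple together with the right tuple. -/
theorem card_join_le {α β γ : Type*} [DecidableEq α] [DecidableEq β]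
    (H : Finset (α × β)) (T : Finset (β × γ)) :
    ((H ×ˢ T).filter (fun q => q.1.2 = q.2.1)).card ≤ (H.image Prod.fst).card * T.card := by
  rw [← Finset.card_product]
  refine Finset.card_le_card_of_injOn (fun q => (q.1.1, q.2)) ?_ ?_
  · rintro ⟨⟨b, c⟩, t⟩ h
    simp only [Finset.coe_filter, Finset.mem_product, Set.mem_ofPred_eq] at h
    exact Finset.mem_coe.2
      (Finset.mem_product.2 ⟨Finset.mem_image_of_mem Prod.fst h.1.1, h.1.2⟩)
  · rintro ⟨⟨b, c⟩, t⟩ h ⟨⟨b', c'⟩, t'⟩ h' heq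
    simp only [Finset.coe_filter, Set.mem_ofPred_eq] at h h'
    simp only [Prod.mk.injEq] at heq
    obtain ⟨rfl, rfl⟩ := heq
    rw [h.2, h'.2]

/-- If every value in `B` has degree at least `k` in `S`, then `k * |B| ≤ |S|`. -/
theorem mul_card_le_card_of_le_degree {α β : Type*} [DecidableEq α]
    (S : Finset (α × β)) (B : Finset α) (k : ℝ)
    (h : ∀ b ∈ B, k ≤ ((S.filter (fun p => p.1 = b)).card : ℝ)) :
    k * (B.card : ℝ) ≤ S.card := by
  have hsum : ∑ b ∈ B, (S.filter (fun p => p.1 = b)).card ≤ S.card :=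
    (Finset.sum_card_fiberwise_eq_card_filter S B Prod.fst).trans_le (Finset.card_filter_le _ _)
  calc k * (B.card : ℝ) = ∑ _b ∈ B, k := by
        rw [Finset.sum_const, nsmul_eq_mul, mul_comm]
    _ ≤ ∑ b ∈ B, ((S.filter (fun p => p.1 = b)).card : ℝ) := Finset.sum_le_sum h
    _ ≤ S.card := by exact_mod_cast hsum

/-- The intermediate result `S_H ⋈ T` of the split-based triangle plan, where
`S_H` is the heavy part of `S` at threshold `√N`, has at most `N^(3/2)`
tuples. -/
theorem stmt_17 {D : Type} [DecidableEq D] (N : ℝ) (hN : 1 ≤ N)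
    (S T : Finset (D × D)) (hS : (S.card : ℝ) ≤ N) (hT : (T.card : ℝ) ≤ N) :
    ((((S.filter (fun q =>
        Real.sqrt N < ((S.filter (fun p => p.1 = q.1)).card : ℝ))) ×ˢ T).filter
        (fun q => q.1.2 = q.2.1)).card : ℝ) ≤ N ^ ((3 : ℝ) / 2) := by
  set H := S.filter (fun q => Real.sqrt N < ((S.filter (fun p => p.1 = q.1)).card : ℝ))
  have hpos : 0 < N := by linarith
  have hsqrt : 0 < Real.sqrt N := Real.sqrt_pos.2 hpos
  have hB : ((H.image Prod.fst).card : ℝ) ≤ Real.sqrt N := by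
    have hle := mul_card_le_card_of_le_degree S (H.image Prod.fst) (Real.sqrt N) (by
      intro b hb
      obtain ⟨q, hq, rfl⟩ := Finset.mem_image.1 hb
      exact (Finset.mem_filter.1 hq).2.le)
    refine le_of_mul_le_mul_left ?_ hsqrt
    rw [Real.mul_self_sqrt hpos.le]
    exact hle.trans hS
  calc (((H ×ˢ T).filter (fun q => q.1.2 = q.2.1)).card : ℝ)
      ≤ ((H.image Prod.fst).card : ℝ) * T.card := by exact_mod_cast card_join_le H T
    _ ≤ Real.sqrt N * N := by gcongr
    _ = N ^ ((3 : ℝ) / 2) := by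
        rw [Real.sqrt_eq_rpow, ← Real.rpow_add_one hpos.ne']
        norm_num
end
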